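/- Let Φ be the standard Gaussian cumulative distribution function, I(x) = Φ'(Φ⁻¹(x)) for x ∈ (0,1), and let M(x,y) = −√(I(x)² + y²) for x ∈ (0,1), y ≥ 0. Then for all x ∈ (0,1) and all y > 0 the 2×2 matrix [[M_xx + M_y/y, M_xy], [M_xy, M_yy]] is negative semidefinite and has determinant zero. -/

import Mathlib

open MeasureTheory Real

/-- The standard Gaussian density `Φ'(t) = (2π)^{-1/2} e^{-t²/2}`. -/
noncomputable def gaussPDF (t : ℝ) : ℝ := Real.exp (-t ^ 2 / 2) / Real.sqrt (2 * Real.pi)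

/-- The standard Gaussian cumulative distribution function `Φ`. -/
noncomputable def Phi (x : ℝ) : ℝ := ∫ s in Set.Iic x, gaussPDF s

/-- The inverse `Φ⁻¹` of the Gaussian cdf (on `(0,1)`). -/
noncomputable def PhiInv : ℝ → ℝ := Function.invFun Phi

/-- The Gaussian isoperimetric profile `I = Φ' ∘ Φ⁻¹`. -/
noncomputable def isoI (x : ℝ) : ℝ := gaussPDF (PhiInv x)

/-- Negative semidefiniteness of a real matrix. -/
def Matrix.NegSemidef' {n : Type*} [Fintype n] (A : Matrix n n ℝ) : Prop :=
  (-A).PosSemidef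

/-- Partial derivative `M_x`. -/
noncomputable def Mx (M : ℝ → ℝ → ℝ) (x y : ℝ) : ℝ := deriv (fun s => M s y) x

/-- Partial derivative `M_y`. -/
noncomputable def My (M : ℝ → ℝ → ℝ) (x y : ℝ) : ℝ := deriv (fun s => M x s) y

/-- Partial derivative `M_xx`. -/
noncomputable def Mxx (M : ℝ → ℝ → ℝ) (x y : ℝ) : ℝ := deriv (fun s => Mx M s y) x

/-- Partial derivative `M_xy`. -/
noncomputable def Mxy (M : ℝ → ℝ → ℝ) (x y : ℝ) : ℝ := deriv (fun s => Mx M x s) y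

/-- Partial derivative `M_yy`. -/
noncomputable def Myy (M : ℝ → ℝ → ℝ) (x y : ℝ) : ℝ := deriv (fun s => My M x s) y

/-- The matrix `[[M_xx + M_y/y, M_xy], [M_xy, M_yy]]`. -/
noncomputable def Mmat (M : ℝ → ℝ → ℝ) (x y : ℝ) : Matrix (Fin 2) (Fin 2) ℝ :=
  !![Mxx M x y + My M x y / y, Mxy M x y; Mxy M x y, Myy M x y]

theorem gaussPDF_pos (t : ℝ) : 0 < gaussPDF t := by
  unfold gaussPDF
  positivity

theorem gaussPDF_eq_gaussianPDFReal : gaussPDF = ProbabilityTheory.gaussianPDFReal 0 1 := by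
  ext t
  simp [gaussPDF, ProbabilityTheory.gaussianPDFReal, div_eq_inv_mul]

theorem continuous_gaussPDF : Continuous gaussPDF := by
  unfold gaussPDF
  fun_prop

theorem integrable_gaussPDF : Integrable gaussPDF :=
  gaussPDF_eq_gaussianPDFReal ▸ ProbabilityTheory.integrable_gaussianPDFReal 0 1

theorem hasDerivAt_gaussPDF (t : ℝ) : HasDerivAt gaussPDF (-t * gaussPDF t) t := by
  have h : HasDerivAt (fun t : ℝ => -t ^ 2 / 2) (-t) t := by
    convert! ((hasDerivAt_pow 2 t).neg.div_const 2) using 1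
    norm_num
    ring
  convert! h.exp.div_const √(2 * π) using 1
  unfold gaussPDF
  ring

theorem Phi_eq_cdf : Phi = ProbabilityTheory.cdf (ProbabilityTheory.gaussianReal 0 1) := by
  ext x
  rw [ProbabilityTheory.cdf_eq_real, measureReal_def,
    ProbabilityTheory.gaussianReal_apply_eq_integral _ one_ne_zero, ENNReal.toReal_ofReal,
    Phi, gaussPDF_eq_gaussianPDFReal]
  exact integral_nonneg (ProbabilityTheory.gaussianPDFReal_nonneg _ _)

theorem hasStrictDerivAt_Phi (t : ℝ) : HasStrictDerivAt Phi (gaussPDF t) t := by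
  have h : Phi = fun x => (∫ s in (0 : ℝ)..x, gaussPDF s) + Phi 0 := by
    ext x
    rw [← intervalIntegral.integral_Iic_sub_Iic integrable_gaussPDF.integrableOn
      integrable_gaussPDF.integrableOn]
    simp [Phi]
  rw [h]
  exact (continuous_gaussPDF.integral_hasStrictDerivAt 0 t).add_const _

theorem strictMono_Phi : StrictMono Phi :=
  strictMono_of_hasDerivAt_pos (fun t => (hasStrictDerivAt_Phi t).hasDerivAt) gaussPDF_pos

theorem PhiInv_Phi (t : ℝ) : PhiInv (Phi t) = t :=
  Function.leftInverse_invFun strictMono_Phi.injective t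

theorem exists_Phi_eq {x : ℝ} (hx : x ∈ Set.Ioo (0 : ℝ) 1) : ∃ t, Phi t = x := by
  have hc : Continuous Phi :=
    continuous_iff_continuousAt.2 fun t => (hasStrictDerivAt_Phi t).hasDerivAt.continuousAt
  have h0 : Filter.Tendsto Phi Filter.atBot (nhds 0) :=
    Phi_eq_cdf ▸ ProbabilityTheory.tendsto_cdf_atBot _
  have h1 : Filter.Tendsto Phi Filter.atTop (nhds 1) :=
    Phi_eq_cdf ▸ ProbabilityTheory.tendsto_cdf_atTop _
  obtain ⟨a, ha⟩ := (h0.eventually_lt_const hx.1).exists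
  obtain ⟨b, hb⟩ := (h1.eventually_const_lt hx.2).exists
  exact mem_range_of_exists_le_of_exists_ge hc ⟨a, ha.le⟩ ⟨b, hb.le⟩

theorem isoI_pos (x : ℝ) : 0 < isoI x := gaussPDF_pos _

theorem hasDerivAt_PhiInv {x : ℝ} (hx : x ∈ Set.Ioo (0 : ℝ) 1) :
    HasDerivAt PhiInv (isoI x)⁻¹ x := by
  obtain ⟨t, rfl⟩ := exists_Phi_eq hx
  rw [isoI, PhiInv_Phi]
  exact ((hasStrictDerivAt_Phi t).to_local_left_inverse (gaussPDF_pos t).ne'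
    (.of_forall PhiInv_Phi)).hasDerivAt

theorem hasDerivAt_isoI {x : ℝ} (hx : x ∈ Set.Ioo (0 : ℝ) 1) :
    HasDerivAt isoI (-PhiInv x) x := by
  convert! (hasDerivAt_gaussPDF (PhiInv x)).comp x (hasDerivAt_PhiInv hx) using 1
  have := (isoI_pos x).ne'
  rw [← isoI]
  field_simp

/-- Bobkov's function `M(x, y) = -√(I(x)² + y²)`. -/
noncomputable def bobkov (x y : ℝ) : ℝ := -√(isoI x ^ 2 + y ^ 2)

theorem bobkov_radicand_pos (x y : ℝ) : 0 < isoI x ^ 2 + y ^ 2 := by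
  have := isoI_pos x
  positivity

theorem bobkov_neg (x y : ℝ) : bobkov x y < 0 :=
  neg_lt_zero.2 (Real.sqrt_pos.2 (bobkov_radicand_pos x y))

theorem bobkov_sq (x y : ℝ) : bobkov x y ^ 2 = isoI x ^ 2 + y ^ 2 := by
  rw [bobkov, neg_sq, Real.sq_sqrt (bobkov_radicand_pos x y).le]

theorem hasDerivAt_bobkov_left {x : ℝ} (hx : x ∈ Set.Ioo (0 : ℝ) 1) (y : ℝ) :
    HasDerivAt (fun s => bobkov s y) (-(isoI x * PhiInv x) / bobkov x y) x := by
  convert! ((((hasDerivAt_isoI hx).pow 2).add_const (y ^ 2)).sqrt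
    (bobkov_radicand_pos x y).ne').neg using 1
  have := (Real.sqrt_pos.2 (bobkov_radicand_pos x y)).ne'
  simp only [bobkov, Pi.pow_apply]
  field_simp
  norm_num
  ring

theorem hasDerivAt_bobkov_right (x y : ℝ) :
    HasDerivAt (bobkov x) (y / bobkov x y) y := by
  convert! (((hasDerivAt_pow 2 y).const_add (isoI x ^ 2)).sqrt
    (bobkov_radicand_pos x y).ne').neg using 1
  have := (Real.sqrt_pos.2 (bobkov_radicand_pos x y)).ne'
  simp only [bobkov]
  field_simp
  norm_num
  ring

theorem Mx_bobkov {x : ℝ} (hx : x ∈ Set.Ioo (0 : ℝ) 1) (y : ℝ) :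
    Mx bobkov x y = -(isoI x * PhiInv x) / bobkov x y :=
  (hasDerivAt_bobkov_left hx y).deriv

theorem My_bobkov (x y : ℝ) : My bobkov x y = y / bobkov x y :=
  (hasDerivAt_bobkov_right x y).deriv

theorem Mxx_bobkov {x : ℝ} (hx : x ∈ Set.Ioo (0 : ℝ) 1) (y : ℝ) :
    Mxx bobkov x y = (PhiInv x ^ 2 - 1) / bobkov x y
      - (isoI x * PhiInv x) ^ 2 / bobkov x y ^ 3 := by
  have hM := (bobkov_neg x y).ne
  have hI := (isoI_pos x).ne'
  have h : (fun s => Mx bobkov s y) =ᶠ[nhds x] fun s => -(isoI s * PhiInv s) / bobkov s y :=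
    Filter.mem_of_superset (Ioo_mem_nhds hx.1 hx.2) fun s hs => Mx_bobkov hs y
  rw [Mxx, h.deriv_eq]
  refine HasDerivAt.deriv ?_
  convert! (((hasDerivAt_isoI hx).mul (hasDerivAt_PhiInv hx)).neg).div
    (hasDerivAt_bobkov_left hx y) hM using 1
  simp only [Pi.neg_apply, Pi.mul_apply]
  field_simp
  ring

theorem Mxy_bobkov {x : ℝ} (hx : x ∈ Set.Ioo (0 : ℝ) 1) (y : ℝ) :
    Mxy bobkov x y = isoI x * PhiInv x * y / bobkov x y ^ 3 := by
  have hM := (bobkov_neg x y).ne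
  rw [Mxy, funext (Mx_bobkov hx)]
  refine HasDerivAt.deriv ?_
  convert! (hasDerivAt_const y (-(isoI x * PhiInv x))).div (hasDerivAt_bobkov_right x y) hM using 1
  field_simp
  ring

theorem Myy_bobkov (x y : ℝ) :
    Myy bobkov x y = isoI x ^ 2 / bobkov x y ^ 3 := by
  have hM := (bobkov_neg x y).ne
  rw [Myy, funext (My_bobkov x)]
  refine HasDerivAt.deriv ?_
  convert! (hasDerivAt_id y).div (hasDerivAt_bobkov_right x y) hM using 1
  simp only [id]
  field_simp
  rw [bobkov_sq]
  ring

theorem Mmat_bobkov {x y : ℝ} (hx : x ∈ Set.Ioo (0 : ℝ) 1) (hy : y ≠ 0) :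
    Mmat bobkov x y = (bobkov x y ^ 3)⁻¹ •
      Matrix.vecMulVec ![PhiInv x * y, isoI x] ![PhiInv x * y, isoI x] := by
  have hM := (bobkov_neg x y).ne
  have h : Mxx bobkov x y + My bobkov x y / y = (PhiInv x * y) ^ 2 / bobkov x y ^ 3 := by
    rw [Mxx_bobkov hx, My_bobkov]
    field_simp
    rw [bobkov_sq]
    ring
  rw [Mmat, h, Mxy_bobkov hx, Myy_bobkov]
  ext i j
  fin_cases i <;> fin_cases j <;> simp <;> ring

/-- for Bobkov's function `M(x,y) = −√(I(x)² + y²)` the matrix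
`[[M_xx + M_y/y, M_xy], [M_xy, M_yy]]` is negative semidefinite with determinant
zero for `x ∈ (0,1)`, `y > 0`. -/
theorem stmt_7 (x y : ℝ) (hx : x ∈ Set.Ioo (0 : ℝ) 1) (hy : 0 < y) :
    (Mmat (fun s t => -Real.sqrt (isoI s ^ 2 + t ^ 2)) x y).NegSemidef' ∧
      (Mmat (fun s t => -Real.sqrt (isoI s ^ 2 + t ^ 2)) x y).det = 0 := by
  change (Mmat bobkov x y).NegSemidef' ∧ (Mmat bobkov x y).det = 0
  rw [Mmat_bobkov hx hy.ne']
  constructor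
  · have hc : 0 ≤ -(bobkov x y ^ 3)⁻¹ :=
      neg_nonneg.2 (inv_nonpos.2 (Odd.pow_neg (by decide) (bobkov_neg x y)).le)
    rw [Matrix.NegSemidef', ← neg_smul]
    exact (Matrix.posSemidef_vecMulVec_self_star ![PhiInv x * y, isoI x]).smul hc
  · rw [Matrix.det_smul, Matrix.det_fin_two]
    simp only [Matrix.vecMulVec_apply]
    ring
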